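/- For every positive integer n and all integers k, t and s, the Fibonacci numbers satisfy ∑_{j=0}^{n} (-1)^j C(n,j) · F_{k+t}^j · F_t^{n-j} · F_{(s+k)n-kj} = (-1)^{n(t+1)} · F_k^n · F_{n(s-t)}. -/

import Mathlib

/-- Fibonacci numbers extended to all integer indices:
`F 0 = 0`, `F 1 = 1`, `F n = F (n-1) + F (n-2)` for all `n : ℤ`
(equivalently `F (-n) = (-1)^(n-1) * F n`). -/
def fibZ (n : ℤ) : ℤ :=
  if 0 ≤ n then Nat.fib n.toNat else (-1) ^ (n.natAbs + 1) * Nat.fib n.natAbs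

/-- Lucas numbers extended to all integer indices:
`L 0 = 2`, `L 1 = 1`, `L n = L (n-1) + L (n-2)` for all `n : ℤ`
(equivalently `L (-n) = (-1)^n * L n`). -/
def lucasZ (n : ℤ) : ℤ := fibZ (n - 1) + fibZ (n + 1)

open Real in
theorem fibZ_binet (n : ℤ) :
    (fibZ n : ℝ) = (goldenRatio ^ n - goldenConj ^ n) / √5 := by
  rw [← coe_intFib_eq]
  congr 1
  unfold fibZ
  split_ifs with h
  · obtain ⟨m, rfl⟩ := Int.eq_ofNat_of_zero_le h
    simp
  · obtain ⟨m, rfl⟩ : ∃ m : ℕ, n = -(m : ℤ) := ⟨n.natAbs, by omega⟩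
    rcases Nat.even_or_odd m with hm | hm
    · simp [Int.fib_neg, hm, pow_succ]
    · simp [Int.fib_neg, hm, pow_succ]

theorem binom_zpow_sum (n : ℕ) (k s : ℤ) (x A B : ℝ) (hx : x ≠ 0) :
    ∑ j ∈ Finset.range (n + 1), (-1 : ℝ) ^ j * (n.choose j : ℝ) * A ^ j * B ^ (n - j) *
      x ^ ((s + k) * (n : ℤ) - k * (j : ℤ)) = (x ^ (s + k) * B - x ^ s * A) ^ n := by
  have e : x ^ (s + k) * B - x ^ s * A = -(x ^ s * A) + x ^ (s + k) * B := by ring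
  rw [e, add_pow]
  refine Finset.sum_congr rfl fun j hj => ?_
  have hj' : j ≤ n := by simpa [Nat.lt_succ_iff] using hj
  have h : x ^ ((s + k) * (n : ℤ) - k * (j : ℤ)) = (x ^ s) ^ j * (x ^ (s + k)) ^ (n - j) := by
    rw [← zpow_natCast, ← zpow_natCast, ← zpow_mul, ← zpow_mul, ← zpow_add₀ hx]
    congr 1
    push_cast [hj']
    ring
  rw [h, neg_pow (x ^ s * A), mul_pow, mul_pow]
  ring

theorem key_factor (k t s : ℤ) (x y F G H : ℝ) (d : ℝ) (hd : d ≠ 0) (hx : x ≠ 0) (hy : y ≠ 0)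
    (hxy : x * y = -1) (hF : F = (x ^ t - y ^ t) / d) (hG : G = (x ^ (k + t) - y ^ (k + t)) / d)
    (hH : H = (x ^ k - y ^ k) / d) :
    x ^ (s + k) * F - x ^ s * G = (-1 : ℝ) ^ (t + 1) * H * x ^ (s - t) := by
  have h1 : (-1 : ℝ) ^ (t + 1) = - (x ^ t * y ^ t) := by
    rw [zpow_add₀ (by norm_num), ← hxy, mul_zpow, hxy]
    simp
  have h2 : x ^ s = x ^ (s - t) * x ^ t := by
    rw [← zpow_add₀ hx]
    congr 1
    ring
  rw [h1, hF, hG, hH, zpow_add₀ hx, zpow_add₀ hx, zpow_add₀ hy, h2]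
  field_simp
  ring

theorem fib_binomial_alternating_sum (n : ℕ) (hn : 0 < n) (k t s : ℤ) :
    ∑ j ∈ Finset.range (n + 1),
      (-1 : ℤ) ^ j * (n.choose j : ℤ) * fibZ (k + t) ^ j * fibZ t ^ (n - j) *
        fibZ ((s + k) * (n : ℤ) - k * (j : ℤ))
      = (((-1 : ℤˣ) ^ ((n : ℤ) * (t + 1)) : ℤˣ) : ℤ) * fibZ k ^ n *
          fibZ ((n : ℤ) * (s - t)) := by
  have hφ := Real.goldenRatio_ne_zero
  have hψ := Real.goldenConj_ne_zero
  have h5 : √(5 : ℝ) ≠ 0 := by positivity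
  have kφ := key_factor k t s _ _ (fibZ t) (fibZ (k + t)) (fibZ k) _ h5 hφ hψ
    Real.goldenRatio_mul_goldenConj (fibZ_binet _) (fibZ_binet _) (fibZ_binet _)
  have kψ := key_factor k t s _ _ (fibZ t) (fibZ (k + t)) (fibZ k) (-√5) (neg_ne_zero.mpr h5) hψ hφ
    Real.goldenConj_mul_goldenRatio (by rw [fibZ_binet, div_neg, ← neg_div, neg_sub])
    (by rw [fibZ_binet, div_neg, ← neg_div, neg_sub])
    (by rw [fibZ_binet, div_neg, ← neg_div, neg_sub])
  have sφ := binom_zpow_sum n k s _ (fibZ (k + t)) (fibZ t) hφ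
  have sψ := binom_zpow_sum n k s _ (fibZ (k + t)) (fibZ t) hψ
  rw [kφ, mul_pow, mul_pow] at sφ
  rw [kψ, mul_pow, mul_pow] at sψ
  have hu : (((((-1 : ℤˣ) ^ ((n : ℤ) * (t + 1)) : ℤˣ) : ℤ)) : ℝ) = ((-1 : ℝ) ^ (t + 1)) ^ n := by
    rw [mul_comm, zpow_mul, zpow_natCast]
    push_cast
    congr 1
    rcases Int.even_or_odd (t + 1) with h | h
    · rw [h.neg_one_zpow, h.neg_one_zpow]; simp
    · rw [h.neg_one_zpow, h.neg_one_zpow]; simp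
  have hp : ∀ x : ℝ, x ^ ((n : ℤ) * (s - t)) = (x ^ (s - t)) ^ n := fun x => by
    rw [mul_comm, zpow_mul, zpow_natCast]
  apply Int.cast_injective (α := ℝ)
  rw [Int.cast_mul, Int.cast_mul, hu, fibZ_binet ((n : ℤ) * (s - t)), hp, hp, Int.cast_pow,
    mul_div_assoc', mul_sub, ← sφ, ← sψ, ← Finset.sum_sub_distrib, Finset.sum_div, Int.cast_sum]
  refine Finset.sum_congr rfl fun j _ => ?_
  push_cast
  rw [fibZ_binet ((s + k) * (n : ℤ) - k * (j : ℤ))]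
  ring
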